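/- Let A be a set with |A| = τ > ω and let Z be a closed subset of ℝ^A containing no nonempty closed G_κ-subset of ℝ^A for any cardinal κ < τ. Then for each subset B ⊆ A with |B| < τ there is a continuous section i : ℝ^B → ℝ^A of the projection π_B : ℝ^A → ℝ^B (i.e. π_B ∘ i = id) such that Z ∩ i(ℝ^B) = ∅. -/

import Mathlib

open Set Topology

universe u

/-- A `G_κ`-subset: an intersection of at most `κ` many open sets. -/
def IsGKappa {X : Type u} [TopologicalSpace X] (κ : Cardinal.{u}) (S : Set X) : Prop :=
  ∃ 𝒪 : Set (Set X), Cardinal.mk ↥𝒪 ≤ κ ∧ (∀ U ∈ 𝒪, IsOpen U) ∧ S = ⋂₀ 𝒪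

/-- Restriction (projection) of `ℝ^A` onto the subproduct `ℝ^B`, `B ⊆ A`. -/
def resTo {A : Type u} (B : Set A) (x : A → ℝ) : ↥B → ℝ := fun b => x b

/-- The set of points agreeing with `w` on `D` is a `G_κ`-set for `κ = max ℵ₀ |D|`. -/
theorem isGKappa_eqOn {A : Type u} (D : Set A) (w : A → ℝ) :
    IsGKappa (max Cardinal.aleph0 (Cardinal.mk ↥D)) {x : A → ℝ | EqOn x w D} := by
  let U : ↥D × ℕ → Set (A → ℝ) := fun p => {x | |x p.1 - w p.1| < 1 / ((p.2 : ℝ) + 1)}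
  refine ⟨range U, ?_, ?_, ?_⟩
  · refine Cardinal.mk_range_le.trans ?_
    rw [Cardinal.mk_prod, Cardinal.lift_uzero, Cardinal.mk_nat, Cardinal.lift_aleph0, max_comm]
    exact Cardinal.mul_le_max_of_aleph0_le_right le_rfl
  · rintro _ ⟨p, rfl⟩
    exact isOpen_lt (by fun_prop) continuous_const
  · ext x
    simp only [mem_ofPred_eq, sInter_range, mem_iInter, Prod.forall, Subtype.forall, U]
    constructor
    · intro h a ha n
      rw [h ha, sub_self, abs_zero]
      positivity
    · intro h a ha
      by_contra hne
      obtain ⟨n, hn⟩ := exists_nat_one_div_lt (abs_pos.mpr (sub_ne_zero.mpr hne))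
      exact lt_asymm hn (h a ha n)

theorem isClosed_setOf_eqOn {A : Type u} (D : Set A) (w : A → ℝ) :
    IsClosed {x : A → ℝ | EqOn x w D} := by
  simp only [EqOn, ofPred_forall]
  exact isClosed_biInter fun a _ => isClosed_eq (continuous_apply a) continuous_const

/-- The open box in `ℝ^B` cut out by finitely many rational interval constraints. -/
def ratBox {A : Type u} {B : Set A} (l : List (↥B × ℚ × ℚ)) : Set (↥B → ℝ) :=
  {y | ∀ c ∈ l, (c.2.1 : ℝ) < y c.1 ∧ y c.1 < c.2.2}

/-- A point off a closed set is separated from it by a rational box in the coordinates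
from `B` together with the exact values of finitely many other coordinates. -/
theorem exists_ratBox_of_notMem {A : Type u} {Z : Set (A → ℝ)} (hZ : IsClosed Z) (B : Set A)
    {x : A → ℝ} (hx : x ∉ Z) :
    ∃ (l : List (↥B × ℚ × ℚ)) (F : Finset A), resTo B x ∈ ratBox l ∧ Disjoint (F : Set A) B ∧
      ∀ z, resTo B z ∈ ratBox l → EqOn z x F → z ∉ Z := by
  classical
  obtain ⟨I, u, hu, hI⟩ := isOpen_pi_iff.mp hZ.isOpen_compl x hx
  have key : ∀ a, ∃ p q : ℚ, a ∈ I → (p : ℝ) < x a ∧ x a < q ∧ Ioo (p : ℝ) q ⊆ u a := by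
    intro a
    by_cases ha : a ∈ I
    · obtain ⟨s, t, ⟨hs, ht⟩, hst⟩ :=
        mem_nhds_iff_exists_Ioo_subset.mp ((hu a ha).1.mem_nhds (hu a ha).2)
      obtain ⟨p, hp, hp'⟩ := exists_rat_btwn hs
      obtain ⟨q, hq, hq'⟩ := exists_rat_btwn ht
      exact ⟨p, q, fun _ => ⟨hp', hq, (Ioo_subset_Ioo hp.le hq'.le).trans hst⟩⟩
    · exact ⟨0, 0, fun h => absurd h ha⟩
  choose p q hpq using key
  refine ⟨(I.subtype (· ∈ B)).toList.map fun b => (b, p b, q b), I.filter (· ∉ B), ?_, ?_, ?_⟩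
  · simp only [ratBox, resTo, mem_ofPred_eq, List.mem_map, Finset.mem_toList, Finset.mem_subtype]
    rintro _ ⟨b, hb, rfl⟩
    exact ⟨(hpq b hb).1, (hpq b hb).2.1⟩
  · rw [Set.disjoint_left]
    intro a ha
    exact (Finset.mem_filter.mp ha).2
  · intro z hz hzx
    refine hI fun a ha => ?_
    by_cases hB : a ∈ B
    · refine (hpq a ha).2.2 ?_
      exact hz (⟨a, hB⟩, p a, q a) (List.mem_map.mpr ⟨⟨a, hB⟩, by simpa using ha, rfl⟩)
    · rw [hzx (Finset.mem_coe.mpr (Finset.mem_filter.mpr ⟨ha, hB⟩))]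
      exact (hu a ha).2

/-- A rational box in `ℝ^B` and finitely many prescribed coordinates outside `B` which
together guarantee missing `Z`. -/
structure AvoidingBox {A : Type u} (Z : Set (A → ℝ)) (B : Set A) where
  box : List (↥B × ℚ × ℚ)
  supp : Finset A
  val : A → ℝ
  disj : Disjoint (supp : Set A) B
  avoid : ∀ z, resTo B z ∈ ratBox box → EqOn z val supp → z ∉ Z

/-- Two avoiding boxes are compatible if they have different constraint lists and their
prescribed values agree. -/
def AvoidingBox.Compat {A : Type u} {Z : Set (A → ℝ)} {B : Set A} (s t : AvoidingBox Z B) : Prop :=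
  s.box ≠ t.box ∧ ∀ a ∈ s.supp, a ∈ t.supp → s.val a = t.val a

theorem AvoidingBox.Compat.symm {A : Type u} {Z : Set (A → ℝ)} {B : Set A} {s t : AvoidingBox Z B}
    (h : s.Compat t) : t.Compat s :=
  ⟨h.1.symm, fun a ha ha' => (h.2 a ha' ha).symm⟩

/-- A family of avoiding boxes with distinct constraint lists prescribes fewer than `|A|` coordinates. -/
theorem mk_biUnion_supp_lt {A : Type u} (hA : Cardinal.aleph0 < Cardinal.mk A)
    {Z : Set (A → ℝ)} {B : Set A} (hB : Cardinal.mk ↥B < Cardinal.mk A)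
    {S : Set (AvoidingBox Z B)} (hS : InjOn AvoidingBox.box S) :
    Cardinal.mk ↥(⋃ s ∈ S, (s.supp : Set A)) < Cardinal.mk A := by
  have hlist : Cardinal.mk (List (↥B × ℚ × ℚ)) < Cardinal.mk A := by
    refine (Cardinal.mk_list_le_max _).trans_lt (max_lt hA ?_)
    rw [Cardinal.mk_prod, Cardinal.lift_uzero]
    refine Cardinal.mul_lt_of_lt hA.le hB ?_
    exact (Cardinal.lift_le_aleph0.mpr Cardinal.mk_le_aleph0).trans_lt hA
  have hScard : Cardinal.mk ↥S < Cardinal.mk A :=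
    (Cardinal.mk_le_of_injective hS.injective).trans_lt hlist
  rw [biUnion_eq_iUnion]
  refine (Cardinal.mk_iUnion_le _).trans_lt ?_
  refine Cardinal.mul_lt_of_lt hA.le hScard (lt_of_le_of_lt ?_ hA)
  exact ciSup_le' fun s => Cardinal.mk_le_aleph0

/-- If a closed `Z ⊆ ℝ^A` (`|A| = τ > ω`) contains no nonempty closed `G_κ`-subset of
`ℝ^A` for any `κ < τ`, then every projection `π_B : ℝ^A → ℝ^B` with `|B| < τ` admits a
continuous section whose image misses `Z`. -/
theorem section_missing_Z
    (A : Type u) (hA : Cardinal.aleph0 < Cardinal.mk A)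
    (Z : Set (A → ℝ)) (hZcl : IsClosed Z)
    (hZG : ∀ κ : Cardinal.{u}, κ < Cardinal.mk A →
      ∀ S : Set (A → ℝ), S ⊆ Z → IsClosed S → IsGKappa κ S → S = ∅)
    (B : Set A) (hB : Cardinal.mk ↥B < Cardinal.mk A) :
    ∃ i : (↥B → ℝ) → (A → ℝ), Continuous i ∧ (∀ y, resTo B (i y) = y) ∧
      Z ∩ Set.range i = ∅ := by
  classical
  obtain ⟨S, hS⟩ : ∃ S : Set (AvoidingBox Z B), IsMaxChain AvoidingBox.Compat S :=
    ⟨_, maxChain_spec⟩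
  have hcompat : S.Pairwise AvoidingBox.Compat := fun s hs t ht hst =>
    (hS.1 hs ht hst).elim id AvoidingBox.Compat.symm
  have hinj : InjOn AvoidingBox.box S := fun s hs t ht h => by
    by_contra hst
    exact (hcompat hs ht hst).1 h
  set C : Set A := ⋃ s ∈ S, (s.supp : Set A)
  have hCcard : Cardinal.mk ↥C < Cardinal.mk A := mk_biUnion_supp_lt hA hB hinj
  obtain ⟨c, hc⟩ : ∃ c : A → ℝ, ∀ s ∈ S, ∀ a ∈ s.supp, c a = s.val a := by
    have : ∀ a, ∃ r : ℝ, ∀ s ∈ S, a ∈ s.supp → r = s.val a := by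
      intro a
      by_cases h : ∃ s ∈ S, a ∈ s.supp
      · obtain ⟨s, hs, has⟩ := h
        refine ⟨s.val a, fun t ht hat => ?_⟩
        by_cases hst : s = t
        · rw [hst]
        · exact (hcompat hs ht hst).2 a has hat
      · exact ⟨0, fun s hs has => absurd ⟨s, hs, has⟩ h⟩
    choose c hc using this
    exact ⟨c, fun s hs a ha => hc a s hs ha⟩
  let i : (↥B → ℝ) → (A → ℝ) := fun y a => if h : a ∈ B then y ⟨a, h⟩ else c a
  have hi : ∀ y, resTo B (i y) = y := fun y => by
    ext b
    simp [resTo, i]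
  have hic : ∀ y, ∀ s ∈ S, EqOn (i y) s.val s.supp := fun y s hs a ha => by
    have : a ∉ B := Set.disjoint_left.mp s.disj ha
    simp only [i, this, dite_false]
    exact hc s hs a ha
  refine ⟨i, ?_, hi, ?_⟩
  · refine continuous_pi fun a => ?_
    by_cases h : a ∈ B
    · simpa only [i, h, dite_true] using continuous_apply _
    · simpa only [i, h, dite_false] using continuous_const
  rw [← disjoint_iff_inter_eq_empty, Set.disjoint_right]
  rintro _ ⟨y, rfl⟩
  have hD : max Cardinal.aleph0 (Cardinal.mk ↥(B ∪ C)) < Cardinal.mk A :=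
    max_lt hA ((Cardinal.mk_union_le _ _).trans_lt (Cardinal.add_lt_of_lt hA.le hB hCcard))
  obtain ⟨x, hx, hxZ⟩ : ∃ x, EqOn x (i y) (B ∪ C) ∧ x ∉ Z := by
    by_contra! h
    have := hZG _ hD _ h (isClosed_setOf_eqOn _ _) (isGKappa_eqOn (B ∪ C) (i y))
    exact (this.le (eqOn_refl (i y) (B ∪ C))).elim
  obtain ⟨l, F, hxl, hF, hav⟩ := exists_ratBox_of_notMem hZcl B hxZ
  have hxy : resTo B x = y := by
    rw [← hi y]
    ext b
    exact hx (Or.inl b.2)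
  rw [hxy] at hxl
  obtain ⟨t, ht, rfl⟩ : ∃ t ∈ S, t.box = l := by
    by_contra! h
    let t : AvoidingBox Z B := ⟨l, F, x, hF, hav⟩
    have hins : IsChain AvoidingBox.Compat (insert t S) := by
      refine hS.1.insert fun s hs _ => Or.inr ⟨h s hs, fun a ha _ => ?_⟩
      rw [← hic y s hs ha]
      exact (hx (Or.inr (mem_biUnion hs ha))).symm
    have htS : t ∈ S := by
      rw [hS.2 hins (subset_insert t S)]
      exact mem_insert t S
    exact h t htS rfl
  exact t.avoid _ (by rwa [hi]) (hic y t ht)
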